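/- Let M be a 3-quasi-Sasakian manifold of rank 4l+3. The following are equivalent: (i) each structure tensor φ_α is projectable with respect to the vertical foliation V; (ii) dη_α = 0 on H for all α ∈ {1,2,3}; (iii) the horizontal distribution H is integrable; (iv) M is locally the Riemannian product of a hyper-Kähler manifold and the 3-dimensional sphere of constant curvature c²/4; (v) M has rank 3. Moreover, if one of these conditions holds, the Ricci tensor of M is Ric = (c²/2)(η_1⊗η_1 + η_2⊗η_2 + η_3⊗η_3), so M is η-Einstein. -/

import Mathlib

/-!
An abstract (Lie–Rinehart style) algebraic model of the differential geometry of
almost contact metric 3-structures: `F` plays the role of the algebra of smooth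
functions on a manifold `M` of dimension `4n+3`, and `V` plays the role of the
`F`-module of smooth vector fields, acting on `F` by derivations and carrying a
Lie bracket, a Riemannian metric `g`, and three almost contact metric structures
`(φ_α, ξ_α, η_α, g)`.
-/

noncomputable section

namespace QS3

/-- Cyclic (= even) permutations of `{0,1,2}`, modelling even permutations of `{1,2,3}`. -/
def Cyclic (a b c : Fin 3) : Prop :=
  (a, b, c) = (0, 1, 2) ∨ (a, b, c) = (1, 2, 0) ∨ (a, b, c) = (2, 0, 1)

/-- The algebraic model of the smooth structure of a manifold: an `ℝ`-algebra `F`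
of smooth functions and an `F`-module `V` of vector fields acting on `F` by
derivations and carrying the Lie bracket of vector fields. -/
class SmoothSetting (F : Type) (V : Type) [CommRing F] [Algebra ℝ F]
    [AddCommGroup V] [Module F V] where
  act : V → F → F
  bracket : V → V → V
  act_add : ∀ (X : V) (f₁ f₂ : F), act X (f₁ + f₂) = act X f₁ + act X f₂
  act_mul : ∀ (X : V) (f₁ f₂ : F), act X (f₁ * f₂) = act X f₁ * f₂ + f₁ * act X f₂
  act_const : ∀ (X : V) (r : ℝ), act X (algebraMap ℝ F r) = 0
  act_addLeft : ∀ (X Y : V) (f : F), act (X + Y) f = act X f + act Y f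
  act_smulLeft : ∀ (f : F) (X : V) (h : F), act (f • X) h = f * act X h
  bracket_antisymm : ∀ X Y : V, bracket X Y = -bracket Y X
  bracket_addLeft : ∀ X Y Z : V, bracket (X + Y) Z = bracket X Z + bracket Y Z
  bracket_act : ∀ (X Y : V) (f : F),
    act (bracket X Y) f = act X (act Y f) - act Y (act X f)
  bracket_smulRight : ∀ (X : V) (f : F) (Y : V),
    bracket X (f • Y) = f • bracket X Y + act X f • Y
  jacobi : ∀ X Y Z : V,
    bracket X (bracket Y Z) + bracket Y (bracket Z X) + bracket Z (bracket X Y) = 0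

section d

variable (F V : Type) [CommRing F] [Algebra ℝ F] [AddCommGroup V] [Module F V]
  [SmoothSetting F V]

/-- The action of a vector field on a function (directional derivative). -/
def der (X : V) (f : F) : F := SmoothSetting.act X f

/-- The Lie bracket of vector fields. -/
def lie (X Y : V) : V := SmoothSetting.bracket F X Y

/-- Exterior differential of a 1-form (with the `1/2` normalization convention,
so that `2 dθ(X,Y) = X θ(Y) - Y θ(X) - θ([X,Y])`). -/
def dOne (θ : V → F) (X Y : V) : F :=
  (2 : ℝ)⁻¹ • (der F V X (θ Y) - der F V Y (θ X) - θ (lie F V X Y))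

/-- Exterior differential of a 2-form (with the `1/3` normalization convention). -/
def dTwo (ω : V → V → F) (X Y Z : V) : F :=
  (3 : ℝ)⁻¹ • (der F V X (ω Y Z) + der F V Y (ω Z X) + der F V Z (ω X Y)
    - ω (lie F V X Y) Z - ω (lie F V Y Z) X - ω (lie F V Z X) Y)

end d

/-- An almost contact metric 3-structure on a manifold of dimension `4n+3`:
three almost contact metric structures `(φ_α, ξ_α, η_α, g)` satisfying the
quaternionic-type relations, together with a (local) orthonormal frame. -/
class ACM3 (F V : Type) [CommRing F] [Algebra ℝ F] [AddCommGroup V] [Module F V]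
    [SmoothSetting F V] where
  n : ℕ
  g : V → V → F
  phi : Fin 3 → V → V
  xi : Fin 3 → V
  eta : Fin 3 → V → F
  g_symm : ∀ X Y, g X Y = g Y X
  g_addLeft : ∀ X Y Z, g (X + Y) Z = g X Z + g Y Z
  g_smulLeft : ∀ (f : F) (X Y : V), g (f • X) Y = f * g X Y
  g_nondeg : ∀ X, (∀ Y, g X Y = 0) → X = 0
  phi_add : ∀ α (X Y : V), phi α (X + Y) = phi α X + phi α Y
  phi_smul : ∀ α (f : F) (X : V), phi α (f • X) = f • phi α X
  eta_eq : ∀ α X, eta α X = g X (xi α)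
  acm_sq : ∀ α X, phi α (phi α X) = -X + eta α X • xi α
  eta_xi : ∀ α, eta α (xi α) = 1
  compat : ∀ α X Y, g (phi α X) (phi α Y) = g X Y - eta α X * eta α Y
  quat_phi : ∀ a b c, Cyclic a b c → ∀ X, phi c X = phi a (phi b X) - eta b X • xi a
  quat_phi' : ∀ a b c, Cyclic a b c → ∀ X, phi c X = -(phi b (phi a X)) + eta a X • xi b
  quat_xi : ∀ a b c, Cyclic a b c → xi c = phi a (xi b)
  quat_xi' : ∀ a b c, Cyclic a b c → xi c = -(phi b (xi a))
  quat_eta : ∀ a b c, Cyclic a b c → ∀ X, eta c X = eta a (phi b X)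
  quat_eta' : ∀ a b c, Cyclic a b c → ∀ X, eta c X = -(eta b (phi a X))
  frame : Fin (4 * n + 3) → V
  frame_orth : ∀ i j, g (frame i) (frame j) = if i = j then 1 else 0
  frame_span : ∀ X : V, X = ∑ i, g X (frame i) • frame i

section acm

variable (F V : Type) [CommRing F] [Algebra ℝ F] [AddCommGroup V] [Module F V]
  [SmoothSetting F V] [ACM3 F V]

/-- The integer `n` (the manifold has dimension `4n+3`). -/
def dimn : ℕ := ACM3.n F V

/-- The Riemannian metric. -/
def gm (X Y : V) : F := ACM3.g X Y

/-- The structure tensors `φ_α`. -/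
def ph (α : Fin 3) (X : V) : V := ACM3.phi F α X

/-- The Reeb vector fields `ξ_α`. -/
def rxi (α : Fin 3) : V := ACM3.xi F α

/-- The 1-forms `η_α`. -/
def et (α : Fin 3) (X : V) : F := ACM3.eta α X

/-- The orthonormal frame. -/
def fr (i : Fin (4 * dimn F V + 3)) : V := ACM3.frame i

/-- The fundamental 2-form `Φ_α(X,Y) = g(X, φ_α Y)`. -/
def Phi (α : Fin 3) (X Y : V) : F := gm F V X (ph F V α Y)

/-- The Nijenhuis torsion `[φ_α, φ_α]` of `φ_α`. -/
def Nij (α : Fin 3) (X Y : V) : V :=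
  ph F V α (ph F V α (lie F V X Y)) + lie F V (ph F V α X) (ph F V α Y)
    - ph F V α (lie F V (ph F V α X) Y) - ph F V α (lie F V X (ph F V α Y))

/-- The normality tensor `N⁽¹⁾_α = [φ_α, φ_α] + 2 dη_α ⊗ ξ_α`. -/
def NOne (α : Fin 3) (X Y : V) : V :=
  Nij F V α X Y + ((2 : ℝ) • dOne F V (et F V α) X Y) • rxi F V α

/-- The structure `(φ_α, ξ_α, η_α)` is normal. -/
def IsNormal (α : Fin 3) : Prop := ∀ X Y, NOne F V α X Y = 0

/-- A 2-form is closed. -/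
def IsClosedTwo (ω : V → V → F) : Prop := ∀ X Y Z, dTwo F V ω X Y Z = 0

/-- The structure `(φ_α, ξ_α, η_α, g)` is quasi-Sasakian: normal with closed
fundamental 2-form. -/
def IsQuasiSasakian (α : Fin 3) : Prop :=
  IsNormal F V α ∧ IsClosedTwo F V (Phi F V α)

/-- `M` is 3-cosymplectic: each structure is normal with `dη_α = 0` and `dΦ_α = 0`. -/
def ThreeCosymplectic : Prop :=
  ∀ α, IsNormal F V α ∧ (∀ X Y, dOne F V (et F V α) X Y = 0) ∧
    IsClosedTwo F V (Phi F V α)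

/-- `M` is 3-α-Sasakian with constant `a ≠ 0`: each structure is normal (an
`α`-Sasakian structure) and `dη_δ = a Φ_δ`. -/
def Is3AlphaSasakianWith (a : ℝ) : Prop :=
  a ≠ 0 ∧ (∀ δ, IsNormal F V δ) ∧
    ∀ (δ : Fin 3) (X Y : V), dOne F V (et F V δ) X Y = algebraMap ℝ F a * Phi F V δ X Y

/-- A vector field is horizontal: it lies in `H = ∩_α ker η_α`. -/
def Horiz (X : V) : Prop := ∀ α, et F V α X = 0

/-- A vector field is vertical: it lies in `V = ⟨ξ₁, ξ₂, ξ₃⟩`. -/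
def InVert (X : V) : Prop :=
  ∃ p q r : F, X = p • rxi F V 0 + q • rxi F V 1 + r • rxi F V 2

/-- The distribution `E^{4m} = {X ∈ H : i_X dη_α = 0}`. -/
def InE4m (X : V) : Prop :=
  Horiz F V X ∧ ∀ (α : Fin 3) (Y : V), dOne F V (et F V α) X Y = 0

/-- The distribution `E^{4l}`: the orthogonal complement of `E^{4m}` in `H`. -/
def InE4l (X : V) : Prop :=
  Horiz F V X ∧ ∀ Y, InE4m F V Y → gm F V X Y = 0

/-- The distribution `E^{4l+3} = E^{4l} ⊕ V`. -/
def InE4l3 (X : V) : Prop :=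
  ∃ Y Z, InE4l F V Y ∧ InVert F V Z ∧ X = Y + Z

/-- The distribution `E^{4m+3} = E^{4m} ⊕ V`. -/
def InE4m3 (X : V) : Prop :=
  ∃ Y Z, InE4m F V Y ∧ InVert F V Z ∧ X = Y + Z

/-- The horizontal component `X_H = X - ∑_α η_α(X) ξ_α` of a vector field. -/
def horComp (X : V) : V := X - ∑ α : Fin 3, et F V α X • rxi F V α

/-- A vector field is basic with respect to the foliation defined by `E^{4m}`. -/
def BasicE4m (X : V) : Prop :=
  InE4l3 F V X ∧ ∀ W, InE4m F V W → InE4m F V (lie F V W X)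

/-- A vector field is basic with respect to the foliation defined by `E^{4l+3}`. -/
def BasicE4l3 (X : V) : Prop :=
  InE4m F V X ∧ ∀ W, InE4l3 F V W → InE4l3 F V (lie F V W X)

end acm

/-- A 3-quasi-Sasakian structure: each of the three almost contact metric
structures is quasi-Sasakian.  We also record, as part of the structure, the
standard structural facts established for such manifolds in the literature
(Cappelletti Montano–De Nicola–Dileo): the Reeb commutation relations
`[ξ_α, ξ_β] = c ξ_γ`, the splitting `H = E^{4l} ⊕ E^{4m}` (constancy of the
rank), the `φ_α`-invariance of both distributions, and the tensors `ψ_α`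
(equal to `φ_α` on `E^{4l+3}` and vanishing on `E^{4m}` when the rank is
`4l+3`, i.e. `c ≠ 0`; equal to `φ_α` on `E^{4l}` and vanishing on `E^{4m+3}`
when the rank is `4l+1`, i.e. `c = 0`). -/
class ThreeQS (F V : Type) [CommRing F] [Algebra ℝ F] [AddCommGroup V] [Module F V]
    [SmoothSetting F V] [ACM3 F V] where
  qs : ∀ α, IsQuasiSasakian F V α
  c : ℝ
  reeb_bracket : ∀ a b c', Cyclic a b c' →
    lie F V (rxi F V a) (rxi F V b) = algebraMap ℝ F c • rxi F V c'
  horiz_split : ∀ X, Horiz F V X → ∃ Y Z, InE4l F V Y ∧ InE4m F V Z ∧ X = Y + Z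
  phi_E4l : ∀ α X, InE4l F V X → InE4l F V (ph F V α X)
  phi_E4m : ∀ α X, InE4m F V X → InE4m F V (ph F V α X)
  psi : Fin 3 → V → V
  psi_add : ∀ α (X Y : V), psi α (X + Y) = psi α X + psi α Y
  psi_smul : ∀ α (f : F) (X : V), psi α (f • X) = f • psi α X
  psi_E4l : ∀ α X, InE4l F V X → psi α X = ph F V α X
  psi_E4m : ∀ α X, InE4m F V X → psi α X = 0
  psi_vert_of_ne : c ≠ 0 → ∀ α β, psi α (rxi F V β) = ph F V α (rxi F V β)
  psi_vert_of_eq : c = 0 → ∀ α β, psi α (rxi F V β) = 0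

section tqs

variable (F V : Type) [CommRing F] [Algebra ℝ F] [AddCommGroup V] [Module F V]
  [SmoothSetting F V] [ACM3 F V] [ThreeQS F V]

/-- The constant `c` with `[ξ_α, ξ_β] = c ξ_γ`. -/
def cc : ℝ := ThreeQS.c F V

/-- The tensors `ψ_α`. -/
def psiT (α : Fin 3) (X : V) : V := ThreeQS.psi F α X

/-- The tensors `θ_α = φ_α - ψ_α`. -/
def thetaT (α : Fin 3) (X : V) : V := ph F V α X - psiT F V α X

/-- The 2-forms `Θ_α(X,Y) = g(X, θ_α Y)`. -/
def ThetaForm (α : Fin 3) (X Y : V) : F := gm F V X (thetaT F V α Y)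

end tqs

/-- The 3-quasi-Sasakian manifold has rank `4l+3`: the constant `c` is nonzero
and the orthonormal frame is adapted to the splitting
`TM = E^{4l} ⊕ E^{4m} ⊕ ⟨ξ₁,ξ₂,ξ₃⟩` with `dim E^{4l} = 4l` (hence
`dim E^{4m} = 4m`, `m = n - l`, and the rank of the `η_α` is `4l+3`). -/
class HasRank (F V : Type) [CommRing F] [Algebra ℝ F] [AddCommGroup V] [Module F V]
    [SmoothSetting F V] [ACM3 F V] [ThreeQS F V] (l : ℕ) : Prop where
  c_ne : cc F V ≠ 0
  l_le : l ≤ dimn F V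
  frame_E4l : ∀ i : Fin (4 * dimn F V + 3), i.val < 4 * l → InE4l F V (fr F V i)
  frame_E4m : ∀ i : Fin (4 * dimn F V + 3), 4 * l ≤ i.val → i.val < 4 * dimn F V →
    InE4m F V (fr F V i)
  frame_xi : ∀ (i : Fin (4 * dimn F V + 3)) (a : Fin 3),
    i.val = 4 * dimn F V + a.val → fr F V i = rxi F V a

/-- The Levi-Civita connection of `g`: the unique torsion-free metric connection. -/
class LeviCivita (F V : Type) [CommRing F] [Algebra ℝ F] [AddCommGroup V] [Module F V]
    [SmoothSetting F V] [ACM3 F V] where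
  nabla : V → V → V
  nabla_addLeft : ∀ X Y Z : V, nabla (X + Y) Z = nabla X Z + nabla Y Z
  nabla_smulLeft : ∀ (f : F) (X Y : V), nabla (f • X) Y = f • nabla X Y
  nabla_addRight : ∀ X Y Z : V, nabla X (Y + Z) = nabla X Y + nabla X Z
  nabla_leibniz : ∀ (X : V) (f : F) (Y : V),
    nabla X (f • Y) = der F V X f • Y + f • nabla X Y
  nabla_metric : ∀ X Y Z : V,
    der F V X (gm F V Y Z) = gm F V (nabla X Y) Z + gm F V Y (nabla X Z)
  nabla_torsionFree : ∀ X Y : V, nabla X Y - nabla Y X = lie F V X Y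

section curv

variable (F V : Type) [CommRing F] [Algebra ℝ F] [AddCommGroup V] [Module F V]
  [SmoothSetting F V] [ACM3 F V] [LeviCivita F V]

/-- The Levi-Civita covariant derivative `∇_X Y`. -/
def nab (X Y : V) : V := LeviCivita.nabla F X Y

/-- The Riemannian curvature `R(X,Y)Z = ∇_X ∇_Y Z - ∇_Y ∇_X Z - ∇_{[X,Y]} Z`. -/
def Rcurv (X Y Z : V) : V :=
  nab F V X (nab F V Y Z) - nab F V Y (nab F V X Z) - nab F V (lie F V X Y) Z

/-- The Ricci tensor `Ric(X,Y) = ∑_i g(R(e_i, X)Y, e_i)`. -/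
def Ric (X Y : V) : F :=
  ∑ i, gm F V (Rcurv F V (fr F V i) X Y) (fr F V i)

/-- The scalar curvature. -/
def Scal : F := ∑ i, Ric F V (fr F V i) (fr F V i)

/-- `M` is Einstein: `Ric = a g` for a constant `a`. -/
def Einstein : Prop :=
  ∃ a : ℝ, ∀ X Y, Ric F V X Y = algebraMap ℝ F a * gm F V X Y

/-- `M` is η-Einstein: `Ric = a g + b ∑_α η_α ⊗ η_α` for constants `a, b`. -/
def EtaEinstein : Prop :=
  ∃ a b : ℝ, ∀ X Y, Ric F V X Y
    = algebraMap ℝ F a * gm F V X Y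
      + algebraMap ℝ F b * ∑ α : Fin 3, et F V α X * et F V α Y

end curv

/-- A (Koszul) linear connection on vector fields. -/
def IsConnection (F V : Type) [CommRing F] [Algebra ℝ F] [AddCommGroup V] [Module F V]
    [SmoothSetting F V] (D : V → V → V) : Prop :=
  (∀ X Y Z : V, D (X + Y) Z = D X Z + D Y Z) ∧
  (∀ (f : F) (X Y : V), D (f • X) Y = f • D X Y) ∧
  (∀ X Y Z : V, D X (Y + Z) = D X Y + D X Z) ∧
  (∀ (X : V) (f : F) (Y : V), D X (f • Y) = der F V X f • Y + f • D X Y)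

end QS3

namespace QS3

section Calculus

variable {F V : Type} [CommRing F] [Algebra ℝ F] [AddCommGroup V] [Module F V]
  [SmoothSetting F V]

lemma der_add (X : V) (f h : F) : der F V X (f + h) = der F V X f + der F V X h :=
  SmoothSetting.act_add X f h

lemma der_mul (X : V) (f h : F) : der F V X (f * h) = der F V X f * h + f * der F V X h :=
  SmoothSetting.act_mul X f h

lemma der_algebraMap (X : V) (r : ℝ) : der F V X (algebraMap ℝ F r) = 0 :=
  SmoothSetting.act_const X r

lemma der_zero (X : V) : der F V X 0 = 0 := by
  simpa using der_algebraMap (F := F) X 0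

lemma der_one (X : V) : der F V X 1 = 0 := by
  simpa using der_algebraMap (F := F) X 1

lemma der_neg (X : V) (f : F) : der F V X (-f) = -der F V X f := by
  have h := der_add X f (-f)
  rw [add_neg_cancel, der_zero] at h
  exact (neg_eq_of_add_eq_zero_right h.symm).symm

lemma der_sub (X : V) (f h : F) : der F V X (f - h) = der F V X f - der F V X h := by
  rw [sub_eq_add_neg, der_add, der_neg, ← sub_eq_add_neg]

lemma der_lie (X Y : V) (f : F) :
    der F V (lie F V X Y) f = der F V X (der F V Y f) - der F V Y (der F V X f) :=
  SmoothSetting.bracket_act X Y f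

lemma lie_swap (X Y : V) : lie F V X Y = -lie F V Y X :=
  SmoothSetting.bracket_antisymm X Y

lemma lie_add_left (X Y Z : V) : lie F V (X + Y) Z = lie F V X Z + lie F V Y Z :=
  SmoothSetting.bracket_addLeft X Y Z

lemma lie_add_right (X Y Z : V) : lie F V X (Y + Z) = lie F V X Y + lie F V X Z := by
  rw [lie_swap, lie_add_left, lie_swap Y, lie_swap Z]; abel

lemma lie_zero_left (X : V) : lie F V 0 X = 0 := by
  simpa using lie_add_left (F := F) 0 0 X

lemma lie_smul_right (X : V) (f : F) (Y : V) :
    lie F V X (f • Y) = f • lie F V X Y + der F V X f • Y :=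
  SmoothSetting.bracket_smulRight X f Y

lemma lie_smul_left (X : V) (f : F) (Y : V) :
    lie F V (f • X) Y = f • lie F V X Y - der F V Y f • X := by
  rw [lie_swap, lie_smul_right, lie_swap Y X]; module

lemma lie_jacobi (X Y Z : V) :
    lie F V X (lie F V Y Z) + lie F V Y (lie F V Z X) + lie F V Z (lie F V X Y) = 0 :=
  SmoothSetting.jacobi X Y Z

lemma real_smul_eq_zero_iff {r : ℝ} (hr : r ≠ 0) (f : F) : r • f = 0 ↔ f = 0 := by
  constructor
  · intro h
    rw [← one_smul ℝ f, ← inv_mul_cancel₀ hr, mul_smul, h, smul_zero]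
  · rintro rfl; exact smul_zero r

lemma eq_zero_of_add_self {f : F} (h : f + f = 0) : f = 0 := by
  rw [← two_smul ℝ, real_smul_eq_zero_iff two_ne_zero] at h
  exact h

lemma two_smul_dOne (θ : V → F) (X Y : V) :
    (2 : ℝ) • dOne F V θ X Y = der F V X (θ Y) - der F V Y (θ X) - θ (lie F V X Y) := by
  rw [dOne, smul_smul, mul_inv_cancel₀ two_ne_zero, one_smul]

lemma dOne_eq_zero_iff (θ : V → F) (X Y : V) :
    dOne F V θ X Y = 0 ↔ der F V X (θ Y) - der F V Y (θ X) - θ (lie F V X Y) = 0 :=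
  real_smul_eq_zero_iff (inv_ne_zero two_ne_zero) _

end Calculus

section Metric

variable {F V : Type} [CommRing F] [Algebra ℝ F] [AddCommGroup V] [Module F V]
  [SmoothSetting F V] [ACM3 F V]

lemma gm_symm (X Y : V) : gm F V X Y = gm F V Y X := ACM3.g_symm X Y

lemma gm_add_left (X Y Z : V) : gm F V (X + Y) Z = gm F V X Z + gm F V Y Z :=
  ACM3.g_addLeft X Y Z

lemma gm_smul_left (f : F) (X Y : V) : gm F V (f • X) Y = f * gm F V X Y :=
  ACM3.g_smulLeft f X Y

variable (F V) in
/-- The metric as a bilinear form. -/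
def metric : V →ₗ[F] V →ₗ[F] F :=
  LinearMap.mk₂ F (gm F V) gm_add_left gm_smul_left
    (fun X Y Z => by simp only [gm_symm X, gm_add_left])
    (fun f X Y => by simp only [gm_symm X, gm_smul_left, smul_eq_mul])

lemma gm_add_right (X Y Z : V) : gm F V X (Y + Z) = gm F V X Y + gm F V X Z :=
  (metric F V X).map_add Y Z

lemma gm_smul_right (f : F) (X Y : V) : gm F V X (f • Y) = f * gm F V X Y :=
  (metric F V X).map_smul f Y

lemma gm_neg_left (X Y : V) : gm F V (-X) Y = -gm F V X Y :=
  (metric F V).map_neg₂ X Y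

lemma gm_neg_right (X Y : V) : gm F V X (-Y) = -gm F V X Y :=
  (metric F V X).map_neg Y

lemma gm_sub_left (X Y Z : V) : gm F V (X - Y) Z = gm F V X Z - gm F V Y Z :=
  (metric F V).map_sub₂ X Y Z

lemma gm_sub_right (X Y Z : V) : gm F V X (Y - Z) = gm F V X Y - gm F V X Z :=
  (metric F V X).map_sub Y Z

lemma gm_zero_left (X : V) : gm F V 0 X = 0 := (metric F V).map_zero₂ X

lemma gm_zero_right (X : V) : gm F V X 0 = 0 := (metric F V X).map_zero

lemma gm_sum_left {ι : Type*} (s : Finset ι) (v : ι → V) (Y : V) :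
    gm F V (∑ i ∈ s, v i) Y = ∑ i ∈ s, gm F V (v i) Y :=
  (metric F V).map_sum₂ s v Y

lemma gm_sum_right {ι : Type*} (s : Finset ι) (X : V) (v : ι → V) :
    gm F V X (∑ i ∈ s, v i) = ∑ i ∈ s, gm F V X (v i) :=
  map_sum (metric F V X) v s

variable (F) in
lemma gm_ext {X Y : V} (h : ∀ Z, gm F V X Z = gm F V Y Z) : X = Y :=
  sub_eq_zero.1 <| ACM3.g_nondeg (F := F) _ fun Z => by
    have := gm_sub_left (F := F) X Y Z
    rw [h Z, sub_self] at this
    exact this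

variable (F) in
lemma frame_expansion (X : V) : X = ∑ i, gm F V X (fr F V i) • fr F V i :=
  ACM3.frame_span X

variable (F V) in
/-- The trace of an endomorphism, computed in the orthonormal frame. -/
def frameTrace (A : V →ₗ[F] V) : F := ∑ i, gm F V (A (fr F V i)) (fr F V i)

lemma frameTrace_comp_comm (A B : V →ₗ[F] V) :
    frameTrace F V (A ∘ₗ B) = frameTrace F V (B ∘ₗ A) := by
  have key (A B : V →ₗ[F] V) : frameTrace F V (A ∘ₗ B) =
      ∑ i, ∑ j, gm F V (B (fr F V i)) (fr F V j) * gm F V (A (fr F V j)) (fr F V i) := by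
    refine Finset.sum_congr rfl fun i _ => ?_
    rw [LinearMap.comp_apply]
    conv_lhs => rw [frame_expansion F (B (fr F V i))]
    rw [map_sum, gm_sum_left]
    exact Finset.sum_congr rfl fun j _ => by rw [map_smul, gm_smul_left]
  rw [key, key, Finset.sum_comm]
  exact Finset.sum_congr rfl fun i _ => Finset.sum_congr rfl fun j _ => mul_comm _ _

lemma frameTrace_add (A B : V →ₗ[F] V) :
    frameTrace F V (A + B) = frameTrace F V A + frameTrace F V B := by
  simp only [frameTrace, LinearMap.add_apply, gm_add_left, Finset.sum_add_distrib]

lemma frameTrace_neg (A : V →ₗ[F] V) : frameTrace F V (-A) = -frameTrace F V A := by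
  simp only [frameTrace, LinearMap.neg_apply, gm_neg_left, Finset.sum_neg_distrib]

lemma frameTrace_sub (A B : V →ₗ[F] V) :
    frameTrace F V (A - B) = frameTrace F V A - frameTrace F V B := by
  rw [sub_eq_add_neg, frameTrace_add, frameTrace_neg, ← sub_eq_add_neg]

lemma frameTrace_eq_zero_of_skew {A : V →ₗ[F] V}
    (hA : ∀ X Y, gm F V (A X) Y = -gm F V X (A Y)) : frameTrace F V A = 0 := by
  refine Finset.sum_eq_zero fun i _ => eq_zero_of_add_self ?_
  have h := hA (fr F V i) (fr F V i)
  rw [gm_symm (fr F V i)] at h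
  linear_combination h

end Metric

section ContactStructure

variable {F V : Type} [CommRing F] [Algebra ℝ F] [AddCommGroup V] [Module F V]
  [SmoothSetting F V] [ACM3 F V]

lemma eta_eq_gm (a : Fin 3) (X : V) : et F V a X = gm F V X (rxi F V a) := ACM3.eta_eq a X

lemma gm_xi_left (a : Fin 3) (X : V) : gm F V (rxi F V a) X = et F V a X := by
  rw [eta_eq_gm, gm_symm]

lemma eta_add (a : Fin 3) (X Y : V) : et F V a (X + Y) = et F V a X + et F V a Y := by
  simp only [eta_eq_gm, gm_add_left]

lemma eta_sub (a : Fin 3) (X Y : V) : et F V a (X - Y) = et F V a X - et F V a Y := by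
  simp only [eta_eq_gm, gm_sub_left]

lemma eta_neg (a : Fin 3) (X : V) : et F V a (-X) = -et F V a X := by
  simp only [eta_eq_gm, gm_neg_left]

lemma eta_smul (a : Fin 3) (f : F) (X : V) : et F V a (f • X) = f * et F V a X := by
  simp only [eta_eq_gm, gm_smul_left]

lemma eta_zero (a : Fin 3) : et F V a 0 = 0 := by
  simp only [eta_eq_gm, gm_zero_left]

variable (F V) in
/-- The structure tensor `φ_a` as a linear map. -/
def phiLin (a : Fin 3) : V →ₗ[F] V where
  toFun := ph F V a
  map_add' := ACM3.phi_add a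
  map_smul' := ACM3.phi_smul a

lemma phi_add (a : Fin 3) (X Y : V) : ph F V a (X + Y) = ph F V a X + ph F V a Y :=
  (phiLin F V a).map_add X Y

lemma phi_sub (a : Fin 3) (X Y : V) : ph F V a (X - Y) = ph F V a X - ph F V a Y :=
  (phiLin F V a).map_sub X Y

lemma phi_neg (a : Fin 3) (X : V) : ph F V a (-X) = -ph F V a X :=
  (phiLin F V a).map_neg X

lemma phi_smul (a : Fin 3) (f : F) (X : V) : ph F V a (f • X) = f • ph F V a X :=
  (phiLin F V a).map_smul f X

lemma phi_zero (a : Fin 3) : ph F V a 0 = 0 := (phiLin F V a).map_zero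

lemma phi_phi (a : Fin 3) (X : V) :
    ph F V a (ph F V a X) = -X + et F V a X • rxi F V a := ACM3.acm_sq a X

lemma gm_phi_phi (a : Fin 3) (X Y : V) :
    gm F V (ph F V a X) (ph F V a Y) = gm F V X Y - et F V a X * et F V a Y :=
  ACM3.compat a X Y

lemma Cyclic.rotate {a b c : Fin 3} (h : Cyclic a b c) : Cyclic b c a := by
  simp only [Cyclic, Prod.mk.injEq] at h ⊢; omega

lemma exists_cyclic_last (c : Fin 3) : ∃ a b, Cyclic a b c := by
  fin_cases c
  exacts [⟨1, 2, by simp [Cyclic]⟩, ⟨2, 0, by simp [Cyclic]⟩, ⟨0, 1, by simp [Cyclic]⟩]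

lemma exists_cyclic_first (a : Fin 3) : ∃ b c, Cyclic a b c :=
  let ⟨b, c, h⟩ := exists_cyclic_last a
  ⟨b, c, h.rotate.rotate⟩

lemma eq_or_cyclic (a b : Fin 3) : a = b ∨ (∃ c, Cyclic a b c) ∨ ∃ c, Cyclic b a c := by
  fin_cases a <;> fin_cases b <;> simp [Cyclic]

lemma Cyclic.eq_or {a b c : Fin 3} (h : Cyclic a b c) (d : Fin 3) :
    d = a ∨ d = b ∨ d = c := by
  simp only [Cyclic, Prod.mk.injEq] at h; omega

lemma Cyclic.xi_eq {a b c : Fin 3} (h : Cyclic a b c) : ph F V a (rxi F V b) = rxi F V c :=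
  (ACM3.quat_xi a b c h).symm

lemma Cyclic.xi_eq_neg {a b c : Fin 3} (h : Cyclic a b c) :
    ph F V b (rxi F V a) = -rxi F V c :=
  neg_eq_iff_eq_neg.1 (ACM3.quat_xi' a b c h).symm

lemma Cyclic.eta_phi {a b c : Fin 3} (h : Cyclic a b c) (X : V) :
    et F V a (ph F V b X) = et F V c X :=
  (ACM3.quat_eta a b c h X).symm

lemma Cyclic.eta_phi_neg {a b c : Fin 3} (h : Cyclic a b c) (X : V) :
    et F V b (ph F V a X) = -et F V c X :=
  neg_eq_iff_eq_neg.1 (ACM3.quat_eta' a b c h X).symm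

lemma eta_xi_self (a : Fin 3) : et F V a (rxi F V a) = 1 := ACM3.eta_xi a

lemma eta_xi_symm (a b : Fin 3) : et F V a (rxi F V b) = et F V b (rxi F V a) := by
  rw [eta_eq_gm, eta_eq_gm, gm_symm]

lemma Cyclic.eta_xi {a b c : Fin 3} (h : Cyclic a b c) : et F V a (rxi F V b) = 0 := by
  have h1 := phi_phi (F := F) a (rxi F V b)
  rw [h.xi_eq, h.rotate.rotate.xi_eq_neg] at h1
  have h2 := congrArg (et F V a) (left_eq_add.1 h1)
  rwa [eta_smul, eta_xi_self, mul_one, eta_zero] at h2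

lemma eta_xi (a b : Fin 3) : et F V a (rxi F V b) = if a = b then 1 else 0 := by
  rcases eq_or_cyclic a b with rfl | ⟨c, h⟩ | ⟨c, h⟩
  · simp [eta_xi_self]
  · rw [if_neg, h.eta_xi]
    rintro rfl; simp [Cyclic] at h; omega
  · rw [if_neg, eta_xi_symm, h.eta_xi]
    rintro rfl; simp [Cyclic] at h; omega

lemma eta_smul_phi_xi (a : Fin 3) (X : V) :
    et F V a X • ph F V a (rxi F V a) = et F V a (ph F V a X) • rxi F V a := by
  have h := phi_phi (F := F) a (ph F V a X)
  rw [phi_phi a X, phi_add, phi_neg, phi_smul] at h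
  exact add_left_cancel h

lemma phi_xi_self (a : Fin 3) : ph F V a (rxi F V a) = 0 := by
  have h1 (d : Fin 3) := eta_smul_phi_xi (F := F) d (rxi F V d)
  simp only [eta_xi_self, one_smul] at h1
  obtain ⟨b, c, h⟩ := exists_cyclic_first a
  have h2 : ph F V c (rxi F V c) = _ - _ := ACM3.quat_phi a b c h (rxi F V c)
  change _ = ph F V a (ph F V b (rxi F V c)) - et F V b (rxi F V c) • rxi F V a at h2
  rw [h.rotate.xi_eq, h.rotate.eta_xi, zero_smul, sub_zero] at h2
  have h3 := congrArg (et F V a) h2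
  rw [h1 c, eta_smul, eta_xi_symm, h.rotate.rotate.eta_xi, mul_zero] at h3
  rw [h1 a, ← h3, zero_smul]

lemma eta_phi_self (a : Fin 3) (X : V) : et F V a (ph F V a X) = 0 := by
  have h := congrArg (et F V a) (eta_smul_phi_xi (F := F) a X)
  rwa [phi_xi_self, smul_zero, eta_zero, eta_smul, eta_xi_self, mul_one, eq_comm] at h

lemma gm_phi_left (a : Fin 3) (X Y : V) :
    gm F V (ph F V a X) Y = -gm F V X (ph F V a Y) := by
  have h := gm_phi_phi (F := F) a X (ph F V a Y)
  rw [phi_phi, gm_add_right, gm_neg_right, gm_smul_right, ← eta_eq_gm, eta_phi_self,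
    eta_phi_self] at h
  linear_combination -h

lemma Horiz.phi {X : V} (hX : Horiz F V X) (a : Fin 3) : Horiz F V (ph F V a X) := by
  intro b
  rcases eq_or_cyclic a b with rfl | ⟨c, h⟩ | ⟨c, h⟩
  · exact eta_phi_self a X
  · rw [h.eta_phi_neg, hX, neg_zero]
  · rw [h.eta_phi, hX]

lemma Horiz.phi_phi {X : V} (hX : Horiz F V X) (a : Fin 3) :
    ph F V a (ph F V a X) = -X := by
  rw [QS3.phi_phi, hX, zero_smul, add_zero]

lemma Horiz.phi_comp {X : V} (hX : Horiz F V X) {a b c : Fin 3} (h : Cyclic a b c) :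
    ph F V a (ph F V b X) = ph F V c X := by
  have h1 : ph F V c X = ph F V a (ph F V b X) - et F V b X • rxi F V a :=
    ACM3.quat_phi a b c h X
  rw [h1, hX, zero_smul, sub_zero]

lemma Horiz.phi_comp_neg {X : V} (hX : Horiz F V X) {a b c : Fin 3} (h : Cyclic a b c) :
    ph F V b (ph F V a X) = -ph F V c X := by
  have h1 : ph F V c X = -ph F V b (ph F V a X) + et F V a X • rxi F V b :=
    ACM3.quat_phi' a b c h X
  rw [h1, hX, zero_smul, add_zero, neg_neg]

lemma Horiz.zero : Horiz F V (0 : V) := fun a => eta_zero a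

lemma Horiz.neg {X : V} (hX : Horiz F V X) : Horiz F V (-X) :=
  fun a => by rw [eta_neg, hX, neg_zero]

lemma Horiz.sub {X Y : V} (hX : Horiz F V X) (hY : Horiz F V Y) : Horiz F V (X - Y) :=
  fun a => by rw [eta_sub, hX, hY, sub_zero]

lemma dOne_eq_zero_iff_eta_lie (a : Fin 3) {X Y : V} (hX : Horiz F V X)
    (hY : Horiz F V Y) :
    dOne F V (et F V a) X Y = 0 ↔ et F V a (lie F V X Y) = 0 := by
  rw [dOne_eq_zero_iff, hX, hY, der_zero, der_zero, sub_zero, zero_sub, neg_eq_zero]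

lemma two_smul_dOne_xi (a b d : Fin 3) :
    (2 : ℝ) • dOne F V (et F V b) (rxi F V a) (rxi F V d) =
      -et F V b (lie F V (rxi F V a) (rxi F V d)) := by
  have h (i j k : Fin 3) : der F V (rxi F V i) (et F V j (rxi F V k)) = 0 := by
    rw [eta_xi]; split_ifs <;> simp [der_zero, der_one]
  rw [two_smul_dOne, h, h, sub_zero, zero_sub]

variable (F V) in
/-- The horizontal projection as a linear map. -/
def horLin : V →ₗ[F] V where
  toFun := horComp F V
  map_add' X Y := by
    simp only [horComp, eta_add, add_smul, Finset.sum_add_distrib]; abel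
  map_smul' f X := by
    simp only [horComp, eta_smul, mul_smul, ← Finset.smul_sum, smul_sub, RingHom.id_apply]

lemma horiz_horComp (X : V) : Horiz F V (horComp F V X) := fun a => by
  have : ∀ a : Fin 3, et F V a (horComp F V X) = et F V a X -
      ∑ b : Fin 3, et F V b X * et F V a (rxi F V b) := fun a => by
    simp only [horComp, eta_eq_gm, gm_sub_left, gm_sum_left, gm_smul_left]
  simp [this, eta_xi]

lemma Horiz.horComp_eq {X : V} (hX : Horiz F V X) : horComp F V X = X := by
  simp [horComp, hX _]

lemma gm_horComp_left (X Y : V) : gm F V (horComp F V X) Y = gm F V X (horComp F V Y) := by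
  simp only [horComp, gm_sub_left, gm_sub_right, gm_sum_left, gm_sum_right, gm_smul_left,
    gm_smul_right, ← eta_eq_gm, gm_xi_left]
  simp only [mul_comm]

lemma horComp_phi (a : Fin 3) (X : V) :
    horComp F V (ph F V a X) = ph F V a (horComp F V X) := by
  refine gm_ext F fun Z => ?_
  rw [gm_horComp_left, gm_phi_left, ← ((horiz_horComp Z).phi a).horComp_eq, ← gm_horComp_left,
    ← gm_phi_left, ← gm_horComp_left, ((horiz_horComp X).phi a).horComp_eq]

variable (F) in
lemma horComp_add_vert (X : V) :
    X = horComp F V X + ∑ a : Fin 3, et F V a X • rxi F V a := by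
  rw [horComp, sub_add_cancel]

variable (F) in
lemma ext_horiz_eta {X Y : V} (h : ∀ Z, Horiz F V Z → gm F V X Z = gm F V Y Z)
    (hη : ∀ a, et F V a X = et F V a Y) : X = Y := by
  refine gm_ext F fun Z => ?_
  rw [horComp_add_vert F Z, gm_add_right, gm_add_right, h _ (horiz_horComp Z)]
  simp only [gm_sum_right, gm_smul_right, ← eta_eq_gm, hη]

end ContactStructure

section QuasiSasakian

variable {F V : Type} [CommRing F] [Algebra ℝ F] [AddCommGroup V] [Module F V]
  [SmoothSetting F V] [ACM3 F V]

lemma IsNormal.nij {a : Fin 3} (hN : IsNormal F V a) (X Y : V) :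
    Nij F V a X Y + (der F V X (et F V a Y) - der F V Y (et F V a X)
      - et F V a (lie F V X Y)) • rxi F V a = 0 := by
  rw [← two_smul_dOne]; exact hN X Y

lemma IsNormal.der_eta {a : Fin 3} (hN : IsNormal F V a) (Y : V) :
    der F V (rxi F V a) (et F V a Y) = et F V a (lie F V (rxi F V a) Y) := by
  have h := congrArg (et F V a) (hN.nij (rxi F V a) Y)
  rw [Nij, phi_xi_self, lie_zero_left, lie_zero_left, phi_zero] at h
  simp only [eta_add, eta_sub, eta_smul, eta_phi_self, eta_zero, eta_xi_self, der_one] at h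
  linear_combination h

lemma IsNormal.lie_phi {a : Fin 3} (hN : IsNormal F V a) (Y : V) :
    lie F V (rxi F V a) (ph F V a Y) = ph F V a (lie F V (rxi F V a) Y) := by
  have h := hN.nij (rxi F V a) Y
  rw [hN.der_eta, Nij, phi_xi_self, lie_zero_left, lie_zero_left, phi_zero, eta_xi_self,
    der_one, sub_zero, sub_zero, sub_self, zero_smul, add_zero, add_zero, ← phi_sub] at h
  have h1 := congrArg (ph F V a) h
  rw [phi_zero, phi_phi, eta_sub, eta_phi_self, ← hN.der_eta, eta_phi_self, der_zero, sub_zero,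
    zero_smul, add_zero, neg_eq_zero, sub_eq_zero] at h1
  exact h1.symm

lemma IsQuasiSasakian.closed {a : Fin 3} (hQ : IsQuasiSasakian F V a) (X Y Z : V) :
    der F V X (gm F V Y (ph F V a Z)) + der F V Y (gm F V Z (ph F V a X))
      + der F V Z (gm F V X (ph F V a Y)) - gm F V (lie F V X Y) (ph F V a Z)
      - gm F V (lie F V Y Z) (ph F V a X) - gm F V (lie F V Z X) (ph F V a Y) = 0 :=
  (real_smul_eq_zero_iff (inv_ne_zero three_ne_zero) _).1 (hQ.2 X Y Z)

lemma IsQuasiSasakian.der_gm_phi {a : Fin 3} (hQ : IsQuasiSasakian F V a) (X Y : V) :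
    der F V (rxi F V a) (gm F V X (ph F V a Y)) =
      gm F V (lie F V (rxi F V a) X) (ph F V a Y)
        + gm F V X (ph F V a (lie F V (rxi F V a) Y)) := by
  have h := hQ.closed (rxi F V a) X Y
  rw [phi_xi_self, lie_swap Y, gm_xi_left, eta_phi_self, gm_neg_left, gm_zero_right, der_zero,
    gm_zero_right, der_zero, gm_symm _ (ph F V a X), gm_phi_left] at h
  linear_combination h

/-- The Reeb vector fields of a quasi-Sasakian structure are Killing. -/
lemma IsQuasiSasakian.killing {a : Fin 3} (hQ : IsQuasiSasakian F V a) (X Y : V) :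
    der F V (rxi F V a) (gm F V X Y) =
      gm F V (lie F V (rxi F V a) X) Y + gm F V X (lie F V (rxi F V a) Y) := by
  have h := hQ.der_gm_phi (ph F V a X) Y
  rw [hQ.1.lie_phi] at h
  simp only [gm_phi_phi, der_sub, der_mul, hQ.1.der_eta] at h
  linear_combination h

lemma Cyclic.two_dOne_eq {a b c : Fin 3} (h : Cyclic a b c) (ha : IsQuasiSasakian F V a)
    (hb : IsQuasiSasakian F V b) (X Y : V) :
    gm F V X (lie F V (rxi F V b) (ph F V a Y) - ph F V a (lie F V (rxi F V b) Y)) =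
      -((2 : ℝ) • dOne F V (et F V c) X Y) := by
  have h1 := ha.closed (rxi F V b) X Y
  rw [h.xi_eq, ← eta_eq_gm, ← eta_eq_gm, gm_xi_left, h.eta_phi_neg, der_neg, hb.killing,
    lie_swap Y, gm_neg_left, gm_symm _ (ph F V a X), gm_phi_left] at h1
  rw [two_smul_dOne, gm_sub_right]
  linear_combination h1

lemma Cyclic.two_dOne_eq' {a b c : Fin 3} (h : Cyclic a b c) (ha : IsQuasiSasakian F V a)
    (hb : IsQuasiSasakian F V b) (X Y : V) :
    gm F V X (lie F V (rxi F V a) (ph F V b Y) - ph F V b (lie F V (rxi F V a) Y)) =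
      (2 : ℝ) • dOne F V (et F V c) X Y := by
  have h1 := hb.closed (rxi F V a) X Y
  rw [h.xi_eq_neg, gm_neg_right, gm_neg_right, ← eta_eq_gm, ← eta_eq_gm, gm_xi_left, h.eta_phi,
    der_neg, ha.killing, lie_swap Y, gm_neg_left, gm_symm _ (ph F V b X), gm_phi_left] at h1
  rw [two_smul_dOne, gm_sub_right]
  linear_combination h1

end QuasiSasakian

section Connection

variable {F V : Type} [CommRing F] [Algebra ℝ F] [AddCommGroup V] [Module F V]
  [SmoothSetting F V] [ACM3 F V] [LeviCivita F V]

lemma nab_add_left (X Y Z : V) : nab F V (X + Y) Z = nab F V X Z + nab F V Y Z :=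
  LeviCivita.nabla_addLeft X Y Z

lemma nab_smul_left (f : F) (X Y : V) : nab F V (f • X) Y = f • nab F V X Y :=
  LeviCivita.nabla_smulLeft f X Y

lemma nab_add_right (X Y Z : V) : nab F V X (Y + Z) = nab F V X Y + nab F V X Z :=
  LeviCivita.nabla_addRight X Y Z

lemma nab_smul_right (X : V) (f : F) (Y : V) :
    nab F V X (f • Y) = der F V X f • Y + f • nab F V X Y :=
  LeviCivita.nabla_leibniz X f Y

lemma der_gm (X Y Z : V) :
    der F V X (gm F V Y Z) = gm F V (nab F V X Y) Z + gm F V Y (nab F V X Z) :=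
  LeviCivita.nabla_metric X Y Z

lemma lie_eq_nab (X Y : V) : lie F V X Y = nab F V X Y - nab F V Y X :=
  (LeviCivita.nabla_torsionFree X Y).symm

lemma nab_neg_left (X Y : V) : nab F V (-X) Y = -nab F V X Y := by
  simpa using nab_smul_left (F := F) (-1) X Y

lemma nab_sub_left (X Y Z : V) : nab F V (X - Y) Z = nab F V X Z - nab F V Y Z := by
  rw [sub_eq_add_neg, nab_add_left, nab_neg_left, ← sub_eq_add_neg]

lemma nab_zero_left (X : V) : nab F V 0 X = 0 := by
  simpa using nab_smul_left (F := F) 0 X X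

lemma nab_zero_right (X : V) : nab F V X 0 = 0 := by
  simpa [der_zero] using nab_smul_right (F := F) X 0 X

lemma nab_neg_right (X Y : V) : nab F V X (-Y) = -nab F V X Y := by
  have h := nab_add_right (F := F) X Y (-Y)
  rw [add_neg_cancel, nab_zero_right] at h
  exact (neg_eq_of_add_eq_zero_right h.symm).symm

lemma nab_sub_right (X Y Z : V) : nab F V X (Y - Z) = nab F V X Y - nab F V X Z := by
  rw [sub_eq_add_neg, nab_add_right, nab_neg_right, ← sub_eq_add_neg]

lemma nab_algebraMap_smul (r : ℝ) (X Y : V) :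
    nab F V X (algebraMap ℝ F r • Y) = algebraMap ℝ F r • nab F V X Y := by
  rw [nab_smul_right, der_algebraMap, zero_smul, zero_add]

variable (F V) in
/-- The curvature `R(X, Y)Z` as a trilinear map. -/
def curvLin : V →ₗ[F] V →ₗ[F] V →ₗ[F] V :=
  LinearMap.mk₂ F
    (fun X Y =>
      { toFun := Rcurv F V X Y
        map_add' := fun Z W => by simp only [Rcurv, nab_add_right]; abel
        map_smul' := fun f Z => by
          simp only [Rcurv, nab_smul_right, nab_add_right, der_lie, RingHom.id_apply]
          module })
    (fun X Y Z => by
      ext W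
      simp only [LinearMap.coe_mk, AddHom.coe_mk, LinearMap.add_apply, Rcurv, nab_add_left,
        nab_add_right, lie_add_left]
      abel)
    (fun f X Y => by
      ext W
      simp only [LinearMap.coe_mk, AddHom.coe_mk, LinearMap.smul_apply, Rcurv, nab_smul_left,
        nab_smul_right, lie_smul_left, nab_sub_left]
      module)
    (fun X Y Z => by
      ext W
      simp only [LinearMap.coe_mk, AddHom.coe_mk, LinearMap.add_apply, Rcurv, nab_add_left,
        nab_add_right, lie_add_right]
      abel)
    (fun f X Y => by
      ext W
      simp only [LinearMap.coe_mk, AddHom.coe_mk, LinearMap.smul_apply, Rcurv, nab_smul_left,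
        nab_smul_right, lie_smul_right, nab_add_left]
      module)

lemma curvLin_apply (X Y Z : V) : curvLin F V X Y Z = Rcurv F V X Y Z := rfl

lemma curv_swap (X Y Z : V) : Rcurv F V X Y Z = -Rcurv F V Y X Z := by
  rw [Rcurv, Rcurv, lie_swap X, nab_neg_left]; abel

lemma curv_bianchi (X Y Z : V) :
    Rcurv F V X Y Z + Rcurv F V Y Z X + Rcurv F V Z X Y = 0 := by
  have h := lie_jacobi (F := F) X Y Z
  simp only [lie_eq_nab, nab_sub_left, nab_sub_right] at h
  simp only [Rcurv, lie_eq_nab, nab_sub_left]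
  rw [← h]; abel

lemma gm_curv_skew (X Y Z W : V) :
    gm F V (Rcurv F V X Y Z) W = -gm F V Z (Rcurv F V X Y W) := by
  have h := der_lie X Y (gm F V Z W)
  simp only [der_gm, der_add] at h
  simp only [Rcurv, gm_sub_left, gm_sub_right]
  linear_combination -h

lemma Ric_eq_frameTrace (X Y : V) :
    Ric F V X Y = frameTrace F V (((curvLin F V).flip X).flip Y) := rfl

lemma Ric_add_left (X Y Z : V) : Ric F V (X + Y) Z = Ric F V X Z + Ric F V Y Z := by
  simp only [Ric, ← curvLin_apply, map_add, LinearMap.add_apply, gm_add_left,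
    Finset.sum_add_distrib]

lemma Ric_add_right (X Y Z : V) : Ric F V X (Y + Z) = Ric F V X Y + Ric F V X Z := by
  simp only [Ric, ← curvLin_apply, map_add, gm_add_left, Finset.sum_add_distrib]

lemma Ric_smul_left (f : F) (X Y : V) : Ric F V (f • X) Y = f * Ric F V X Y := by
  simp only [Ric, ← curvLin_apply, map_smul, LinearMap.smul_apply, gm_smul_left,
    Finset.mul_sum]

lemma Ric_smul_right (f : F) (X Y : V) : Ric F V X (f • Y) = f * Ric F V X Y := by
  simp only [Ric, ← curvLin_apply, map_smul, gm_smul_left, Finset.mul_sum]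

lemma Ric_symm (X Y : V) : Ric F V X Y = Ric F V Y X := by
  have h : frameTrace F V (curvLin F V X Y) = 0 :=
    frameTrace_eq_zero_of_skew (gm_curv_skew X Y)
  rw [← sub_eq_zero, Ric_eq_frameTrace, Ric_eq_frameTrace, ← frameTrace_sub, ← neg_eq_zero,
    ← frameTrace_neg, ← h]
  congr 1
  ext Z
  simp only [LinearMap.neg_apply, LinearMap.sub_apply, LinearMap.flip_apply, curvLin_apply]
  have h1 := curv_bianchi (F := F) X Y Z
  rw [curv_swap Y Z] at h1
  rw [← sub_eq_zero, ← neg_eq_zero, ← h1]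
  abel

end Connection

section Killing

variable {F V : Type} [CommRing F] [Algebra ℝ F] [AddCommGroup V] [Module F V]
  [SmoothSetting F V] [ACM3 F V] [LeviCivita F V]

lemma IsQuasiSasakian.gm_nab_xi {a : Fin 3} (hQ : IsQuasiSasakian F V a) (X Y : V) :
    gm F V (nab F V X (rxi F V a)) Y = -gm F V (nab F V Y (rxi F V a)) X := by
  have h := hQ.killing X Y
  rw [der_gm, lie_eq_nab, lie_eq_nab, gm_sub_left, gm_sub_right,
    gm_symm X (nab F V Y (rxi F V a))] at h
  linear_combination h

lemma IsQuasiSasakian.dOne_eta {a : Fin 3} (hQ : IsQuasiSasakian F V a) (X Y : V) :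
    dOne F V (et F V a) X Y = gm F V (nab F V X (rxi F V a)) Y := by
  rw [← sub_eq_zero, ← real_smul_eq_zero_iff (two_ne_zero (α := ℝ)), smul_sub, two_smul_dOne,
    two_smul ℝ (gm F V _ _)]
  simp only [eta_eq_gm, der_gm, lie_eq_nab, gm_sub_left]
  rw [gm_symm Y, gm_symm X, hQ.gm_nab_xi Y X]
  ring

lemma IsQuasiSasakian.nab_xi_self {a : Fin 3} (hQ : IsQuasiSasakian F V a) :
    nab F V (rxi F V a) (rxi F V a) = 0 := by
  refine gm_ext F fun Y => ?_
  rw [hQ.gm_nab_xi, gm_zero_left, neg_eq_zero]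
  have h := der_gm (F := F) Y (rxi F V a) (rxi F V a)
  rw [gm_symm (rxi F V a) (nab F V _ _), ← eta_eq_gm, eta_xi_self, der_one] at h
  exact eq_zero_of_add_self h.symm

lemma lie_self_eq_zero (X : V) : lie F V X X = 0 := by
  rw [lie_eq_nab (F := F), sub_self]

end Killing

section RankThree

variable {F V : Type} [CommRing F] [Algebra ℝ F] [AddCommGroup V] [Module F V]
  [SmoothSetting F V] [ACM3 F V] [ThreeQS F V]

lemma Cyclic.lie_xi {a b c : Fin 3} (h : Cyclic a b c) :
    lie F V (rxi F V a) (rxi F V b) = algebraMap ℝ F (cc F V) • rxi F V c :=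
  ThreeQS.reeb_bracket a b c h

lemma algebraMap_cc :
    algebraMap ℝ F (cc F V) = algebraMap ℝ F (cc F V / 2) + algebraMap ℝ F (cc F V / 2) := by
  rw [← map_add, add_halves]

variable [LeviCivita F V]

lemma Horiz.gm_lie_xi {X : V} (hX : Horiz F V X) (a b : Fin 3) :
    gm F V X (lie F V (rxi F V a) (rxi F V b)) = 0 := by
  rcases eq_or_cyclic a b with rfl | ⟨c, h⟩ | ⟨c, h⟩
  · rw [lie_self_eq_zero (F := F), gm_zero_right]
  · rw [h.lie_xi, gm_smul_right, ← eta_eq_gm, hX, mul_zero]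
  · rw [lie_swap, h.lie_xi, gm_neg_right, gm_smul_right, ← eta_eq_gm, hX, mul_zero, neg_zero]

lemma Horiz.dOne_xi {X : V} (hX : Horiz F V X) (a b : Fin 3) :
    dOne F V (et F V a) X (rxi F V b) = 0 := by
  have h := (ThreeQS.qs (F := F) (V := V) b).killing X (rxi F V a)
  rw [hX.gm_lie_xi, ← eta_eq_gm, ← eta_eq_gm, hX, der_zero, add_zero] at h
  rw [dOne_eq_zero_iff, hX, der_zero, lie_swap, eta_neg, ← h, eta_xi]
  split_ifs <;> simp [der_zero, der_one]

lemma dOne_eq_zero_of_horiz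
    (h : ∀ (a : Fin 3) (X Y : V), Horiz F V X → Horiz F V Y → dOne F V (et F V a) X Y = 0)
    (a : Fin 3) {X : V} (hX : Horiz F V X) (Y : V) : dOne F V (et F V a) X Y = 0 := by
  have hd := (ThreeQS.qs (F := F) (V := V) a).dOne_eta X
  have h1 := h a X _ hX (horiz_horComp Y)
  rw [hd] at h1 ⊢
  rw [horComp_add_vert F Y, gm_add_right, gm_sum_right, h1, zero_add]
  refine Finset.sum_eq_zero fun b _ => ?_
  rw [gm_smul_right, ← hd, hX.dOne_xi, mul_zero]

variable (F V) in
/-- The rank three condition: `i_X dη_a = 0` for every horizontal vector field `X`. -/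
def RankThree : Prop := ∀ X : V, Horiz F V X → InE4m F V X

variable (F V) in
lemma rankThree_iff : RankThree F V ↔
    ∀ (a : Fin 3) (X Y : V), Horiz F V X → Horiz F V Y → dOne F V (et F V a) X Y = 0 :=
  ⟨fun h a X Y hX _ => (h X hX).2 a Y,
    fun h _ hX => ⟨hX, fun a Y => dOne_eq_zero_of_horiz h a hX Y⟩⟩

variable (F V) in
lemma projectable_iff_rankThree :
    (∀ (a b : Fin 3) (X : V), horComp F V (lie F V (rxi F V b) (ph F V a X)
        - ph F V a (lie F V (rxi F V b) X)) = 0) ↔ RankThree F V := by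
  have hQ := ThreeQS.qs (F := F) (V := V)
  constructor
  · intro h
    rw [rankThree_iff]
    intro c X Y hX _
    obtain ⟨a, b, habc⟩ := exists_cyclic_last c
    have h1 := habc.two_dOne_eq (hQ a) (hQ b) X Y
    rw [← hX.horComp_eq, gm_horComp_left, h, gm_zero_right, hX.horComp_eq, eq_comm,
      neg_eq_zero, real_smul_eq_zero_iff two_ne_zero] at h1
    exact h1
  · intro h a b X
    refine gm_ext F fun Z => ?_
    have hZ := fun c => (h _ (horiz_horComp Z)).2 c X
    rw [gm_horComp_left, gm_zero_left, gm_symm]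
    rcases eq_or_cyclic a b with rfl | ⟨c, habc⟩ | ⟨c, habc⟩
    · rw [(hQ a).1.lie_phi, sub_self, gm_zero_right]
    · rw [habc.two_dOne_eq (hQ a) (hQ b), hZ, smul_zero, neg_zero]
    · rw [habc.two_dOne_eq' (hQ b) (hQ a), hZ, smul_zero]

namespace RankThree

lemma nab_horiz_xi (h : RankThree F V) {X : V} (hX : Horiz F V X) (a : Fin 3) :
    nab F V X (rxi F V a) = 0 :=
  gm_ext F fun Y => by
    rw [← (ThreeQS.qs (F := F) (V := V) a).dOne_eta, (h X hX).2, gm_zero_left]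

lemma horiz_nab (h : RankThree F V) (X : V) {Y : V} (hY : Horiz F V Y) :
    Horiz F V (nab F V X Y) := fun a => by
  have h1 := der_gm (F := F) X Y (rxi F V a)
  rw [gm_symm Y (nab F V _ _), (ThreeQS.qs (F := F) (V := V) a).gm_nab_xi X Y, h.nab_horiz_xi hY,
    gm_zero_left, neg_zero, add_zero, ← eta_eq_gm, ← eta_eq_gm, hY, der_zero] at h1
  exact h1.symm

lemma horiz_lie (h : RankThree F V) {X Y : V} (hX : Horiz F V X) (hY : Horiz F V Y) :
    Horiz F V (lie F V X Y) := by
  rw [lie_eq_nab (F := F)]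
  exact (h.horiz_nab X hY).sub (h.horiz_nab Y hX)

lemma horiz_curv (h : RankThree F V) (X Y : V) {Z : V} (hZ : Horiz F V Z) :
    Horiz F V (Rcurv F V X Y Z) :=
  ((h.horiz_nab X (h.horiz_nab Y hZ)).sub (h.horiz_nab Y (h.horiz_nab X hZ))).sub
    (h.horiz_nab _ hZ)

lemma nab_xi_xi (h : RankThree F V) {a b c : Fin 3} (habc : Cyclic a b c) :
    nab F V (rxi F V a) (rxi F V b) = algebraMap ℝ F (cc F V / 2) • rxi F V c := by
  have hQ := ThreeQS.qs (F := F) (V := V) b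
  refine ext_horiz_eta F (fun Z hZ => ?_) fun e => ?_
  · rw [hQ.gm_nab_xi, h.nab_horiz_xi hZ, gm_zero_left, gm_smul_left, gm_xi_left, hZ, mul_zero,
      neg_zero]
  · rw [eta_eq_gm, ← hQ.dOne_eta, eta_smul, ← sub_eq_zero,
      ← real_smul_eq_zero_iff (two_ne_zero (α := ℝ)), smul_sub, two_smul_dOne_xi, two_smul]
    rcases habc.eq_or e with rfl | rfl | rfl
    · rw [lie_self_eq_zero (F := F), eta_zero, eta_xi_symm, habc.rotate.rotate.eta_xi]; ring
    · rw [habc.lie_xi, eta_smul, habc.rotate.eta_xi]; ring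
    · rw [lie_swap, habc.rotate.rotate.lie_xi, eta_neg, eta_smul, eta_xi_self, eta_xi_self,
        algebraMap_cc]
      ring

lemma nab_xi_xi' (h : RankThree F V) {a b c : Fin 3} (habc : Cyclic a b c) :
    nab F V (rxi F V b) (rxi F V a) = -(algebraMap ℝ F (cc F V / 2) • rxi F V c) := by
  have h1 := lie_eq_nab (F := F) (rxi F V a) (rxi F V b)
  rw [h.nab_xi_xi habc, habc.lie_xi, algebraMap_cc, add_smul] at h1
  rw [← sub_eq_iff_eq_add'.2 (eq_sub_iff_add_eq.1 h1).symm]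
  abel

lemma curv_xi (h : RankThree F V) {a b c : Fin 3} (habc : Cyclic a b c) :
    Rcurv F V (rxi F V a) (rxi F V b) (rxi F V b) =
      algebraMap ℝ F (cc F V ^ 2 / 4) • rxi F V a := by
  have hk : algebraMap ℝ F (cc F V ^ 2 / 4) =
      algebraMap ℝ F (cc F V / 2) * algebraMap ℝ F (cc F V / 2) := by
    rw [← map_mul]; congr 1; ring
  rw [Rcurv, (ThreeQS.qs b).nab_xi_self, nab_zero_right, h.nab_xi_xi habc,
    nab_algebraMap_smul, h.nab_xi_xi habc.rotate, habc.lie_xi, nab_smul_left,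
    h.nab_xi_xi' habc.rotate, algebraMap_cc, hk]
  module

lemma curv_xi' (h : RankThree F V) {a b c : Fin 3} (habc : Cyclic a b c) :
    Rcurv F V (rxi F V b) (rxi F V a) (rxi F V a) =
      algebraMap ℝ F (cc F V ^ 2 / 4) • rxi F V b := by
  have hk : algebraMap ℝ F (cc F V ^ 2 / 4) =
      algebraMap ℝ F (cc F V / 2) * algebraMap ℝ F (cc F V / 2) := by
    rw [← map_mul]; congr 1; ring
  rw [Rcurv, (ThreeQS.qs a).nab_xi_self, nab_zero_right, h.nab_xi_xi' habc, nab_neg_right,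
    nab_algebraMap_smul, h.nab_xi_xi' habc.rotate.rotate, lie_swap, habc.lie_xi, nab_neg_left,
    nab_smul_left, h.nab_xi_xi habc.rotate.rotate, algebraMap_cc, hk]
  module

lemma curv_xi_xi_xi (h : RankThree F V) {a b c : Fin 3} (habc : Cyclic a b c) :
    Rcurv F V (rxi F V c) (rxi F V a) (rxi F V b) = 0 := by
  rw [Rcurv, h.nab_xi_xi habc, h.nab_xi_xi' habc.rotate, habc.rotate.rotate.lie_xi,
    nab_neg_right, nab_algebraMap_smul, nab_algebraMap_smul, nab_smul_left,
    (ThreeQS.qs a).nab_xi_self, (ThreeQS.qs b).nab_xi_self, (ThreeQS.qs c).nab_xi_self]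
  simp

lemma curv_horiz_xi (h : RankThree F V) {X : V} (hX : Horiz F V X) (a b : Fin 3) :
    Rcurv F V (rxi F V a) X (rxi F V b) = 0 := by
  have h1 : nab F V X (nab F V (rxi F V a) (rxi F V b)) = 0 := by
    rcases eq_or_cyclic a b with rfl | ⟨c, habc⟩ | ⟨c, habc⟩
    · rw [(ThreeQS.qs a).nab_xi_self, nab_zero_right]
    · rw [h.nab_xi_xi habc, nab_algebraMap_smul, h.nab_horiz_xi hX, smul_zero]
    · rw [h.nab_xi_xi' habc, nab_neg_right, nab_algebraMap_smul, h.nab_horiz_xi hX, smul_zero,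
        neg_zero]
  have h2 : Horiz F V (lie F V (rxi F V a) X) := by
    rw [lie_eq_nab (F := F), h.nab_horiz_xi hX, sub_zero]
    exact h.horiz_nab _ hX
  rw [Rcurv, h1, h.nab_horiz_xi hX, nab_zero_right, h.nab_horiz_xi h2, sub_zero, sub_zero]

end RankThree

end RankThree

section Parallel

variable {F V : Type} [CommRing F] [Algebra ℝ F] [AddCommGroup V] [Module F V]
  [SmoothSetting F V] [ACM3 F V] [LeviCivita F V]

variable (F) in
/-- The tensor `g((∇_X φ_a) Y, Z)`. -/
def phiDer (a : Fin 3) (X Y Z : V) : F :=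
  gm F V (nab F V X (ph F V a Y) - ph F V a (nab F V X Y)) Z

lemma phiDer_neg_left (a : Fin 3) (X Y Z : V) :
    phiDer F a (-X) Y Z = -phiDer F a X Y Z := by
  simp only [phiDer, nab_neg_left, phi_neg, gm_sub_left, gm_neg_left]; ring

lemma phiDer_swap (a : Fin 3) (X Y Z : V) : phiDer F a X Z Y = -phiDer F a X Y Z := by
  have h := der_gm (F := F) X (ph F V a Y) Z
  have h1 := der_gm (F := F) X Y (ph F V a Z)
  rw [gm_phi_left, der_neg, gm_symm (ph F V a Y)] at h
  rw [gm_symm Y (nab F V X _)] at h1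
  simp only [phiDer, gm_sub_left, gm_phi_left] at h ⊢
  linear_combination -h - h1

lemma phiDer_phi_mid (a : Fin 3) (X : V) {Y Z : V} (hY : Horiz F V Y) (hZ : Horiz F V Z) :
    phiDer F a X (ph F V a Y) Z = phiDer F a X Y (ph F V a Z) := by
  simp only [phiDer, gm_sub_left, gm_phi_left, hY.phi_phi, hZ.phi_phi, nab_neg_right,
    gm_neg_left, gm_neg_right]
  ring

lemma IsQuasiSasakian.phiDer_cyclic {a : Fin 3} (hQ : IsQuasiSasakian F V a) (X Y Z : V) :
    phiDer F a X Y Z + phiDer F a Y Z X + phiDer F a Z X Y = 0 := by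
  have h := hQ.closed X Y Z
  simp only [der_gm, lie_eq_nab, gm_sub_left] at h
  have h1 (X Y Z : V) : phiDer F a X Z Y =
      gm F V Y (nab F V X (ph F V a Z)) + gm F V (nab F V X Z) (ph F V a Y) := by
    rw [phiDer, gm_sub_left, gm_symm, gm_phi_left]; ring
  rw [← neg_eq_zero, neg_add, neg_add, ← phiDer_swap, ← phiDer_swap, ← phiDer_swap, h1, h1, h1]
  linear_combination h

lemma IsNormal.phiDer_nij {a : Fin 3} (hN : IsNormal F V a) {X Y : V}
    (hXY : dOne F V (et F V a) X Y = 0) (hη : et F V a (lie F V X Y) = 0)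
    (hX : Horiz F V X) (hY : Horiz F V Y) (Z : V) :
    phiDer F a (ph F V a X) Y Z - phiDer F a (ph F V a Y) X Z
      + phiDer F a X (ph F V a Y) Z - phiDer F a Y (ph F V a X) Z = 0 := by
  have h := hN X Y
  rw [NOne, hXY, smul_zero, zero_smul, add_zero, Nij, phi_phi, hη, zero_smul, add_zero] at h
  have h1 := congrArg (gm F V · Z) h
  simp only [lie_eq_nab, phi_sub, gm_sub_left, gm_add_left, gm_neg_left, gm_zero_left] at h1
  simp only [phiDer, hX.phi_phi, hY.phi_phi, nab_neg_right, gm_sub_left, gm_neg_left]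
  linear_combination h1

end Parallel

section RankThree

variable {F V : Type} [CommRing F] [Algebra ℝ F] [AddCommGroup V] [Module F V]
  [SmoothSetting F V] [ACM3 F V] [ThreeQS F V] [LeviCivita F V]

namespace RankThree

lemma phiDer_phi_left (h : RankThree F V) (a : Fin 3) {X Y Z : V} (hX : Horiz F V X)
    (hY : Horiz F V Y) (hZ : Horiz F V Z) :
    phiDer F a (ph F V a X) Y Z = -phiDer F a X Y (ph F V a Z) := by
  have hQ := ThreeQS.qs (F := F) (V := V) a
  let S (X Y Z : V) : F := phiDer F a (ph F V a X) Y Z + phiDer F a X Y (ph F V a Z)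
  have symm12 {X Y Z : V} (hX : Horiz F V X) (hY : Horiz F V Y) (hZ : Horiz F V Z) :
      S X Y Z = S Y X Z := by
    have h1 := hQ.1.phiDer_nij ((h X hX).2 a Y) (h.horiz_lie hX hY a) hX hY Z
    rw [phiDer_phi_mid a X hY hZ, phiDer_phi_mid a Y hX hZ] at h1
    linear_combination h1
  have anti23 {X Y Z : V} (hY : Horiz F V Y) (hZ : Horiz F V Z) :
      S X Z Y = -S X Y Z := by
    have h1 := phiDer_swap (F := F) a X Z (ph F V a Y)
    rw [phiDer_phi_mid a X hY hZ] at h1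
    have h2 := phiDer_swap (F := F) a (ph F V a X) Y Z
    linear_combination h2 + h1
  have key : S X Y Z = -S X Y Z := by
    calc S X Y Z = S Y X Z := symm12 hX hY hZ
      _ = -S Y Z X := anti23 hZ hX
      _ = -S Z Y X := by rw [symm12 hY hZ hX]
      _ = S Z X Y := by rw [anti23 hX hY, neg_neg]
      _ = S X Z Y := symm12 hZ hX hY
      _ = -S X Y Z := anti23 hY hZ
  have h0 : S X Y Z = 0 := eq_zero_of_add_self (by linear_combination key)
  linear_combination h0

lemma phiDer_eq_zero (h : RankThree F V) (a : Fin 3) {X Y Z : V} (hX : Horiz F V X)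
    (hY : Horiz F V Y) (hZ : Horiz F V Z) : phiDer F a X Y Z = 0 := by
  have hQ := ThreeQS.qs (F := F) (V := V) a
  have rel {X Y Z : V} (hX : Horiz F V X) (hY : Horiz F V Y) (hZ : Horiz F V Z) :
      phiDer F a (ph F V a X) Y Z - phiDer F a (ph F V a Y) Z X
        - phiDer F a (ph F V a Z) X Y = 0 := by
    have h1 := hQ.phiDer_cyclic (ph F V a X) Y Z
    rw [phiDer_phi_mid a Z hX hY] at h1
    rw [h.phiDer_phi_left a hY hZ hX, h.phiDer_phi_left a hZ hX hY]
    linear_combination h1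
  have zero {X Y Z : V} (hX : Horiz F V X) (hY : Horiz F V Y) (hZ : Horiz F V Z) :
      phiDer F a (ph F V a X) Y Z = 0 :=
    eq_zero_of_add_self (by linear_combination -rel hY hZ hX - rel hZ hX hY)
  have h2 := zero (hX.phi a) hY hZ
  rwa [hX.phi_phi, phiDer_neg_left, neg_eq_zero] at h2

lemma nab_phi (h : RankThree F V) (a : Fin 3) {X Y : V} (hX : Horiz F V X)
    (hY : Horiz F V Y) : nab F V X (ph F V a Y) = ph F V a (nab F V X Y) := by
  rw [← sub_eq_zero]
  refine ext_horiz_eta F (fun Z hZ => ?_) fun e => ?_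
  · rw [gm_zero_left]; exact h.phiDer_eq_zero a hX hY hZ
  · rw [eta_zero]
    exact (h.horiz_nab X (hY.phi a)).sub ((h.horiz_nab X hY).phi a) e

lemma curv_phi (h : RankThree F V) (a : Fin 3) {X Y Z : V} (hX : Horiz F V X)
    (hY : Horiz F V Y) (hZ : Horiz F V Z) :
    Rcurv F V X Y (ph F V a Z) = ph F V a (Rcurv F V X Y Z) := by
  rw [Rcurv, Rcurv, h.nab_phi a hY hZ, h.nab_phi a hX hZ, h.nab_phi a (h.horiz_lie hX hY) hZ,
    h.nab_phi a hX (h.horiz_nab Y hZ), h.nab_phi a hY (h.horiz_nab X hZ), phi_sub, phi_sub]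

end RankThree

end RankThree

lemma Cyclic.sum_eq {R : Type*} [AddCommMonoid R] {a b c : Fin 3} (h : Cyclic a b c)
    (f : Fin 3 → R) :
    ∑ d, f d = f a + f b + f c := by
  rw [Fin.sum_univ_three]
  simp only [Cyclic, Prod.mk.injEq] at h
  rcases h with ⟨rfl, rfl, rfl⟩ | ⟨rfl, rfl, rfl⟩ | ⟨rfl, rfl, rfl⟩ <;> abel

section Ricci

variable {F V : Type} [CommRing F] [Algebra ℝ F] [AddCommGroup V] [Module F V]
  [SmoothSetting F V] [ACM3 F V]

lemma frameTrace_of_horiz {A : V →ₗ[F] V} (hA : ∀ Z, Horiz F V (A Z)) :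
    frameTrace F V A = frameTrace F V (A ∘ₗ horLin F V) := by
  rw [frameTrace_comp_comm]
  congr 1
  ext Z
  exact (hA Z).horComp_eq.symm

lemma frameTrace_of_vert {A : V →ₗ[F] V}
    (hA : ∀ Z W, Horiz F V W → gm F V (A Z) W = 0) :
    frameTrace F V A = ∑ a : Fin 3, et F V a (A (rxi F V a)) := by
  have h1 (i) : gm F V (A (fr F V i)) (fr F V i) =
      ∑ a : Fin 3, gm F V (rxi F V a) (fr F V i) * et F V a (A (fr F V i)) := by
    conv_lhs => rw [horComp_add_vert F (fr F V i)]
    rw [gm_add_right, gm_sum_right, ← horComp_add_vert F (fr F V i), hA _ _ (horiz_horComp _),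
      zero_add]
    exact Finset.sum_congr rfl fun a _ => by rw [gm_smul_right, ← eta_eq_gm, gm_xi_left]
  simp only [frameTrace, h1]
  rw [Finset.sum_comm]
  refine Finset.sum_congr rfl fun a _ => ?_
  conv_rhs => rw [frame_expansion F (rxi F V a), map_sum]
  simp only [map_smul, eta_eq_gm, gm_sum_left, gm_smul_left]

variable [LeviCivita F V]

lemma curv_self (X Y : V) : Rcurv F V X X Y = 0 := by
  rw [Rcurv, lie_self_eq_zero (F := F), nab_zero_left, sub_self, sub_zero]

lemma eta_curv_xi_self (a : Fin 3) (X Y : V) : et F V a (Rcurv F V X Y (rxi F V a)) = 0 := by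
  refine eq_zero_of_add_self ?_
  have h := gm_curv_skew (F := F) X Y (rxi F V a) (rxi F V a)
  rw [gm_xi_left, ← eta_eq_gm] at h
  linear_combination h

variable [ThreeQS F V]

namespace RankThree

lemma frameTrace_phi_curv (h : RankThree F V) {a b c : Fin 3} (habc : Cyclic a b c)
    {X W : V} (hX : Horiz F V X) (hW : Horiz F V W) :
    frameTrace F V (phiLin F V a ∘ₗ curvLin F V X W ∘ₗ horLin F V) = 0 := by
  set A := phiLin F V a ∘ₗ curvLin F V X W ∘ₗ horLin F V
  have hP (Z : V) := horiz_horComp (F := F) Z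
  have h1 : (A ∘ₗ phiLin F V b) ∘ₗ (phiLin F V b ∘ₗ horLin F V) = -A := by
    ext Z
    change ph F V a (Rcurv F V X W (horComp F V (ph F V b (ph F V b (horComp F V Z))))) =
      -ph F V a (Rcurv F V X W (horComp F V Z))
    rw [(hP Z).phi_phi, (hP Z).neg.horComp_eq, ← curvLin_apply, map_neg, phi_neg, curvLin_apply]
  have h2 : (phiLin F V b ∘ₗ horLin F V) ∘ₗ (A ∘ₗ phiLin F V b) = A := by
    ext Z
    change ph F V b (horComp F V (ph F V a (Rcurv F V X W (horComp F V (ph F V b Z))))) =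
      ph F V a (Rcurv F V X W (horComp F V Z))
    have hR := h.horiz_curv X W (hP Z)
    rw [horComp_phi b Z, h.curv_phi b hX hW (hP Z), ((hR.phi b).phi a).horComp_eq,
      (hR.phi b).phi_comp_neg habc, ← (hR.phi b).phi_comp habc, hR.phi_phi, phi_neg, neg_neg]
  have h3 := frameTrace_comp_comm (A ∘ₗ phiLin F V b) (phiLin F V b ∘ₗ horLin F V)
  rw [h1, h2, frameTrace_neg] at h3
  exact eq_zero_of_add_self (by linear_combination -h3)

lemma Ric_eq_neg_Ric_phi (h : RankThree F V) (a : Fin 3) {X Y : V} (hX : Horiz F V X)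
    (hY : Horiz F V Y) : Ric F V X Y = -Ric F V (ph F V a Y) (ph F V a X) := by
  obtain ⟨b, c, habc⟩ := exists_cyclic_first a
  have hR (X : V) {Y : V} (hY : Horiz F V Y) : Ric F V X Y =
      frameTrace F V ((((curvLin F V).flip X).flip Y) ∘ₗ horLin F V) :=
    frameTrace_of_horiz (A := ((curvLin F V).flip X).flip Y) fun Z => h.horiz_curv Z X hY
  rw [← sub_eq_zero, sub_neg_eq_add, hR X hY, hR _ (hX.phi a), ← frameTrace_add,
    ← h.frameTrace_phi_curv habc hX (hY.phi a)]
  congr 1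
  ext Z
  change Rcurv F V (horComp F V Z) X Y + Rcurv F V (horComp F V Z) (ph F V a Y) (ph F V a X) =
    ph F V a (Rcurv F V X (ph F V a Y) (horComp F V Z))
  have hZ := horiz_horComp (F := F) Z
  have h1 := congrArg (ph F V a) (curv_bianchi (F := F) (horComp F V Z) X (ph F V a Y))
  rw [h.curv_phi a hZ hX hY, curv_swap (ph F V a Y), phi_add, phi_add, phi_neg, phi_zero,
    ← h.curv_phi a hZ (hY.phi a) hX, (h.horiz_curv _ X hY).phi_phi] at h1
  rw [← sub_eq_zero, ← neg_eq_zero, ← h1]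
  abel

lemma Ric_horiz_horiz (h : RankThree F V) {X Y : V} (hX : Horiz F V X) (hY : Horiz F V Y) :
    Ric F V X Y = 0 := by
  have h012 : Cyclic 0 1 2 := Or.inl rfl
  have hneg (X Y : V) : Ric F V (-X) (-Y) = Ric F V X Y := by
    rw [← neg_one_smul F X, ← neg_one_smul F Y, Ric_smul_left, Ric_smul_right]; ring
  have h1 := h.Ric_eq_neg_Ric_phi 0 hX hY
  rw [h.Ric_eq_neg_Ric_phi 1 (hY.phi 0) (hX.phi 0), hX.phi_comp_neg h012,
    hY.phi_comp_neg h012, hneg, neg_neg] at h1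
  have h2 := h.Ric_eq_neg_Ric_phi 2 hX hY
  rw [Ric_symm (ph F V 2 Y)] at h2
  exact eq_zero_of_add_self (by linear_combination h1 + h2)

lemma Ric_xi_right (h : RankThree F V) (X : V) (a : Fin 3) :
    Ric F V X (rxi F V a) =
      ∑ b : Fin 3, et F V b (Rcurv F V (rxi F V b) X (rxi F V a)) :=
  frameTrace_of_vert (A := ((curvLin F V).flip X).flip (rxi F V a)) fun Z W hW => by
    change gm F V (Rcurv F V Z X (rxi F V a)) W = 0
    rw [gm_curv_skew, gm_xi_left, h.horiz_curv Z X hW, neg_zero]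

lemma Ric_horiz_xi (h : RankThree F V) {X : V} (hX : Horiz F V X) (a : Fin 3) :
    Ric F V X (rxi F V a) = 0 := by
  rw [h.Ric_xi_right]
  exact Finset.sum_eq_zero fun b _ => by rw [h.curv_horiz_xi hX, eta_zero]

lemma Ric_xi_self (h : RankThree F V) (a : Fin 3) :
    Ric F V (rxi F V a) (rxi F V a) = algebraMap ℝ F (cc F V ^ 2 / 2) := by
  obtain ⟨b, c, habc⟩ := exists_cyclic_first a
  rw [h.Ric_xi_right, habc.sum_eq, curv_self, h.curv_xi' habc, h.curv_xi habc.rotate.rotate,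
    eta_zero, eta_smul, eta_smul, eta_xi_self, eta_xi_self, zero_add, mul_one, ← map_add]
  congr 1; ring

lemma Ric_xi_xi_of_cyclic (h : RankThree F V) {a b c : Fin 3} (habc : Cyclic a b c) :
    Ric F V (rxi F V a) (rxi F V b) = 0 := by
  rw [h.Ric_xi_right, habc.sum_eq, curv_self, eta_zero, eta_curv_xi_self,
    h.curv_xi_xi_xi habc, eta_zero, add_zero, add_zero]

lemma Ric_xi_xi (h : RankThree F V) (a b : Fin 3) :
    Ric F V (rxi F V a) (rxi F V b) =
      algebraMap ℝ F (cc F V ^ 2 / 2) * et F V a (rxi F V b) := by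
  rcases eq_or_cyclic a b with rfl | ⟨c, habc⟩ | ⟨c, habc⟩
  · rw [h.Ric_xi_self, eta_xi_self, mul_one]
  · rw [h.Ric_xi_xi_of_cyclic habc, habc.eta_xi, mul_zero]
  · rw [Ric_symm, h.Ric_xi_xi_of_cyclic habc, eta_xi_symm, habc.eta_xi, mul_zero]

lemma Ric_xi (h : RankThree F V) (X : V) (a : Fin 3) :
    Ric F V X (rxi F V a) = algebraMap ℝ F (cc F V ^ 2 / 2) * et F V a X := by
  rw [horComp_add_vert F X]
  simp only [Fin.sum_univ_three, Ric_add_left, Ric_smul_left, h.Ric_horiz_xi (horiz_horComp X),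
    h.Ric_xi_xi, eta_add, eta_smul, horiz_horComp X a, eta_xi_symm a]
  ring

theorem Ric_eq (h : RankThree F V) (X Y : V) :
    Ric F V X Y = algebraMap ℝ F (cc F V ^ 2 / 2) *
      ∑ a : Fin 3, et F V a X * et F V a Y := by
  have h1 : Ric F V X (horComp F V Y) = 0 := by
    conv_lhs => rw [horComp_add_vert F X]
    simp only [Fin.sum_univ_three, Ric_add_left, Ric_smul_left,
      h.Ric_horiz_horiz (horiz_horComp X) (horiz_horComp Y), Ric_symm (rxi F V _),
      h.Ric_horiz_xi (horiz_horComp Y)]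
    ring
  conv_lhs => rw [horComp_add_vert F Y]
  simp only [Fin.sum_univ_three, Ric_add_right, Ric_smul_right, h.Ric_xi, h1]
  ring

end RankThree

end Ricci

/-- For a 3-quasi-Sasakian manifold of rank `4l+3` the following
are equivalent: (i) each `φ_α` is projectable w.r.t. `V`; (ii) `dη_α = 0` on
`H`; (iii) `H` is integrable; (iv) `M` is locally the Riemannian product of a
hyper-Kähler manifold and the 3-sphere of constant curvature `c²/4`; (v) `M`
has rank 3.  Moreover, in that case `Ric = (c²/2) ∑_α η_α ⊗ η_α`
(`M` is η-Einstein). -/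
theorem rank_three_tfae (F V : Type) [CommRing F] [Algebra ℝ F] [AddCommGroup V] [Module F V]
    [SmoothSetting F V] [ACM3 F V] [ThreeQS F V] [LeviCivita F V]
    (l : ℕ) [HasRank F V l] :
    ((∀ (α β : Fin 3) (X : V),
      horComp F V (lie F V (rxi F V β) (ph F V α X)
        - ph F V α (lie F V (rxi F V β) X)) = 0) ↔
     (∀ (α : Fin 3) (X Y : V), Horiz F V X → Horiz F V Y →
      dOne F V (et F V α) X Y = 0)) ∧
    ((∀ (α : Fin 3) (X Y : V), Horiz F V X → Horiz F V Y →
      dOne F V (et F V α) X Y = 0) ↔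
     (∀ X Y : V, Horiz F V X → Horiz F V Y → Horiz F V (lie F V X Y))) ∧
    ((∀ X Y : V, Horiz F V X → Horiz F V Y → Horiz F V (lie F V X Y)) ↔
     ((∀ X Y : V, Horiz F V Y → Horiz F V (nab F V X Y)) ∧
      (∀ (α : Fin 3) (X Y : V), Horiz F V X → Horiz F V Y →
        nab F V X (ph F V α Y) = ph F V α (nab F V X Y)) ∧
      (∀ a b c' : Fin 3, Cyclic a b c' →
        Rcurv F V (rxi F V a) (rxi F V b) (rxi F V b)
          = algebraMap ℝ F (cc F V ^ 2 / 4) • rxi F V a))) ∧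
    (((∀ X Y : V, Horiz F V Y → Horiz F V (nab F V X Y)) ∧
      (∀ (α : Fin 3) (X Y : V), Horiz F V X → Horiz F V Y →
        nab F V X (ph F V α Y) = ph F V α (nab F V X Y)) ∧
      (∀ a b c' : Fin 3, Cyclic a b c' →
        Rcurv F V (rxi F V a) (rxi F V b) (rxi F V b)
          = algebraMap ℝ F (cc F V ^ 2 / 4) • rxi F V a)) ↔
     (∀ X : V, Horiz F V X → InE4m F V X)) ∧
    ((∀ X : V, Horiz F V X → InE4m F V X) →
      ∀ X Y : V, Ric F V X Y
        = algebraMap ℝ F (cc F V ^ 2 / 2)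
            * ∑ α : Fin 3, et F V α X * et F V α Y) := by
  have hd := rankThree_iff F V
  have hi : (∀ X Y : V, Horiz F V X → Horiz F V Y → Horiz F V (lie F V X Y)) ↔
      RankThree F V := by
    rw [hd]
    exact ⟨fun h a X Y hX hY => (dOne_eq_zero_iff_eta_lie a hX hY).2 (h X Y hX hY a),
      fun h X Y hX hY a => (dOne_eq_zero_iff_eta_lie a hX hY).1 (h a X Y hX hY)⟩
  have hp : RankThree F V ↔ ((∀ X Y : V, Horiz F V Y → Horiz F V (nab F V X Y)) ∧
      (∀ (α : Fin 3) (X Y : V), Horiz F V X → Horiz F V Y →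
        nab F V X (ph F V α Y) = ph F V α (nab F V X Y)) ∧
      (∀ a b c' : Fin 3, Cyclic a b c' →
        Rcurv F V (rxi F V a) (rxi F V b) (rxi F V b)
          = algebraMap ℝ F (cc F V ^ 2 / 4) • rxi F V a)) := by
    refine ⟨fun h => ⟨fun X Y hY => h.horiz_nab X hY, fun a X Y hX hY => h.nab_phi a hX hY,
      fun a b c habc => h.curv_xi habc⟩, fun h => hi.1 fun X Y hX hY => ?_⟩
    rw [lie_eq_nab (F := F)]
    exact (h.1 X Y hY).sub (h.1 Y X hX)
  exact ⟨(projectable_iff_rankThree F V).trans hd, hd.symm.trans hi.symm, hi.trans hp, hp.symm,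
    fun h => RankThree.Ric_eq h⟩

end QS3
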